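/- arXiv:1412.5655 — 2 statements merged into one kernel-verified Lean document; each statement's English description precedes it below -/
import Mathlib

section
/- There exist universal constants ε₀ > 0, c > 0 and N such that for all n ≥ N the following holds. Let μ be a probability distribution over deterministic non-adaptive q-query algorithms, i.e., over pairs (Q,T) with Q : {1,…,q} → {−1,1}^n and T : {−1,1}^q → {accept, reject}, where the algorithm (Q,T) applied to f : {−1,1}^n → {−1,1} outputs T(f(Q(1)),…,f(Q(q))). Suppose that for every monotone f : {−1,1}^n → {−1,1} the probability over (Q,T) ∼ μ that the output is accept is at least 2/3, and for every f that is ε₀-far from monotone this probability is at most 1/3. Then q ≥ c · n^{1/5} · (log₂ n)^{−2/5}. -/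
open Finset

/-- `f` is monotone (as a Boolean function, identifying `false ↦ -1`, `true ↦ 1`). -/
def IsMono {α : Type*} [Preorder α] (f : α → Bool) : Prop :=
  ∀ x y : α, x ≤ y → f x ≤ f y

/-- Normalized Hamming distance between two Boolean functions on a finite domain. -/
noncomputable def distB {α : Type*} [Fintype α] (f g : α → Bool) : ℝ :=
  ((Finset.univ.filter (fun x => f x ≠ g x)).card : ℝ) / (Fintype.card α : ℝ)

/-- `f` is `ε`-far from monotone. -/
def FarFromMono {α : Type*} [Fintype α] [Preorder α] (ε : ℝ) (f : α → Bool) : Prop :=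
  ∀ g : α → Bool, IsMono g → ε < distB f g

/-- The probability that the randomized non-adaptive `q`-query algorithm given by the
distribution `μ` over pairs `(Q, T)` accepts the function `f`. -/
noncomputable def acceptProb {n q : ℕ}
    (μ : (Fin q → (Fin n → Bool)) × ((Fin q → Bool) → Bool) → ℝ)
    (f : (Fin n → Bool) → Bool) : ℝ :=
  ∑ p : (Fin q → (Fin n → Bool)) × ((Fin q → Bool) → Bool),
    μ p * (if p.2 (fun i => f (p.1 i)) then 1 else 0)

/-- `x` satisfies the term `t`. -/
def Sat {m n : ℕ} (e : Fin m × Fin m → Fin n) (t : Fin m → Fin m) (x : Fin n → Bool) : Prop :=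
  ∀ c, x (e (c, t c)) = true

open Classical in
/-- The set of terms satisfied by `x`. -/
noncomputable def SS {m n N : ℕ} (e : Fin m × Fin m → Fin n) (T : Fin N → Fin m → Fin m)
    (x : Fin n → Bool) : Finset (Fin N) := Finset.univ.filter (fun i => Sat e (T i) x)

open Classical in
/-- Talagrand-type function with bits `h`. -/
noncomputable def FF {m n N : ℕ} (e : Fin m × Fin m → Fin n) (T : Fin N → Fin m → Fin m)
    (h : Fin N → Bool) (x : Fin n → Bool) : Bool :=
  decide (2 ≤ (SS e T x).card ∨ ∃ i ∈ SS e T x, h i = true)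

/-- The twist. -/
def zz {m n : ℕ} (e : Fin m × Fin m → Fin n) (k l : Fin m × Fin m) (x : Fin n → Bool) : Bool :=
  xor (x (e k)) (x (e l))

/-- The no-functions. -/
noncomputable def FN {m n N : ℕ} (e : Fin m × Fin m → Fin n) (T : Fin N → Fin m → Fin m)
    (b : Fin N → Bool) (k l : Fin m × Fin m) (x : Fin n → Bool) : Bool :=
  FF e T (fun i => xor (b i) (zz e k l x)) x

lemma mem_SS {m n N : ℕ} (e : Fin m × Fin m → Fin n) (T : Fin N → Fin m → Fin m)
    (x : Fin n → Bool) (i : Fin N) : i ∈ SS e T x ↔ Sat e (T i) x := by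
  classical
  simp only [SS, Finset.mem_filter, Finset.mem_univ, true_and]

lemma SS_mono {m n N : ℕ} (e : Fin m × Fin m → Fin n) (T : Fin N → Fin m → Fin m)
    {x y : Fin n → Bool} (h : x ≤ y) : SS e T x ⊆ SS e T y := by
  classical
  intro i hi
  rw [mem_SS] at *
  intro c
  exact Bool.le_iff_imp.mp (h (e (c, T i c))) (hi c)

lemma FF_mono {m n N : ℕ} (e : Fin m × Fin m → Fin n) (T : Fin N → Fin m → Fin m)
    (b : Fin N → Bool) : IsMono (FF e T b) := by
  classical
  intro x y h
  have hs := SS_mono e T h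
  have hc := Finset.card_le_card hs
  rw [Bool.le_iff_imp]
  simp only [FF, decide_eq_true_eq]
  rintro (h2 | ⟨i, hi, hb⟩)
  · left; omega
  · right; exact ⟨i, hs hi, hb⟩

/-- The bad event. -/
def Bad {m n N q : ℕ} (e : Fin m × Fin m → Fin n) (Q : Fin q → Fin n → Bool)
    (T : Fin N → Fin m → Fin m) (k l : Fin m × Fin m) : Prop :=
  ∃ a a' : Fin q, (∃ i, SS e T (Q a) = {i} ∧ SS e T (Q a') = {i}) ∧
    zz e k l (Q a) ≠ zz e k l (Q a')

lemma couple {m n N q : ℕ} (e : Fin m × Fin m → Fin n) (Q : Fin q → Fin n → Bool)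
    (T : Fin N → Fin m → Fin m) (k l : Fin m × Fin m) (hB : ¬ Bad e Q T k l)
    (g : (Fin q → Bool) → ℝ) :
    ∑ b : Fin N → Bool, g (fun a => FN e T b k l (Q a)) =
      ∑ b : Fin N → Bool, g (fun a => FF e T b (Q a)) := by
  classical
  let v : Fin N → Bool := fun i => decide (∃ a, SS e T (Q a) = {i} ∧ zz e k l (Q a) = true)
  have hv : ∀ a i, SS e T (Q a) = {i} → v i = zz e k l (Q a) := by
    intro a i hi
    by_cases hz : zz e k l (Q a) = true
    · rw [hz]; simp only [v, decide_eq_true_eq]; exact ⟨a, hi, hz⟩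
    · have : v i = false := by
        simp only [v, decide_eq_false_iff_not]
        rintro ⟨a', h1, h2⟩
        exact hB ⟨a, a', ⟨i, hi, h1⟩, by rw [h2]; exact hz⟩
      rw [this]; simpa using hz
  have hinv : Function.Involutive (fun (b : Fin N → Bool) => fun i => xor (b i) (v i)) := by
    intro b; funext i; simp
  refine Fintype.sum_equiv hinv.toPerm _ _ ?_
  intro b
  congr 1
  funext a
  simp only [FN, FF, Function.Involutive.coe_toPerm]
  congr 1
  by_cases h2 : 2 ≤ (SS e T (Q a)).card
  · simp [h2]
  · rcases Nat.lt_or_ge (SS e T (Q a)).card 1 with h0 | h1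
    · have : SS e T (Q a) = ∅ := by rw [← Finset.card_eq_zero]; omega
      simp [this]
    · obtain ⟨i, hi⟩ := Finset.card_eq_one.mp (by omega : (SS e T (Q a)).card = 1)
      simp [hi, hv a i hi]

/-- Number of coordinates with `y = 1`, `x = 0`. -/
def dp {m n : ℕ} (e : Fin m × Fin m → Fin n) (x y : Fin n → Bool) : ℕ :=
  (Finset.univ.filter (fun p : Fin m × Fin m => y (e p) = true ∧ x (e p) = false)).card

open Classical in
lemma sat_card {m n : ℕ} (e : Fin m × Fin m → Fin n) (x y : Fin n → Bool) (hm : 0 < m) :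
    ((Finset.univ.filter (fun t => Sat e t x ∧ Sat e t y)).card : ℝ) ≤
      Real.exp (-(dp e x y : ℝ) / m) * ((Finset.univ.filter (fun t => Sat e t y)).card : ℝ) := by
  have h1 : (Finset.univ.filter (fun t => Sat e t x ∧ Sat e t y)) =
      Fintype.piFinset (fun c => Finset.univ.filter
        (fun v : Fin m => x (e (c, v)) = true ∧ y (e (c, v)) = true)) := by
    ext t; simp only [Finset.mem_filter, Finset.mem_univ, true_and, Fintype.mem_piFinset, forall_and]; rfl
  have h2 : (Finset.univ.filter (fun t => Sat e t y)) =
      Fintype.piFinset (fun c => Finset.univ.filter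
        (fun v : Fin m => y (e (c, v)) = true)) := by
    ext t; simp only [Finset.mem_filter, Finset.mem_univ, true_and, Fintype.mem_piFinset]; rfl
  have h3 : dp e x y = ∑ c, (Finset.univ.filter
        (fun v : Fin m => y (e (c, v)) = true ∧ x (e (c, v)) = false)).card := by
    simp only [dp, Finset.card_filter, Fintype.sum_prod_type]
  rw [h1, h2, Fintype.card_piFinset, Fintype.card_piFinset, h3]
  push_cast
  rw [← Finset.sum_neg_distrib, Finset.sum_div, Real.exp_sum, ← Finset.prod_mul_distrib]
  refine Finset.prod_le_prod (fun _ _ => by positivity) ?_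
  intro c _
  have h4 : (Finset.univ.filter (fun v : Fin m => y (e (c, v)) = true)).card =
     (Finset.univ.filter (fun v : Fin m => x (e (c, v)) = true ∧ y (e (c, v)) = true)).card +
     (Finset.univ.filter (fun v : Fin m => y (e (c, v)) = true ∧ x (e (c, v)) = false)).card := by
    rw [← Finset.card_union_of_disjoint]
    · congr 1; ext v; simp only [Finset.mem_filter, Finset.mem_union, Finset.mem_univ, true_and]
      cases x (e (c, v)) <;> simp
    · rw [Finset.disjoint_filter]; intro v _ h h'; simp_all
  have h5 : (Finset.univ.filter (fun v : Fin m => y (e (c, v)) = true)).card ≤ m := by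
    simpa using Finset.card_le_univ (Finset.univ.filter (fun v : Fin m => y (e (c, v)) = true))
  generalize (Finset.univ.filter (fun v : Fin m => y (e (c, v)) = true)).card = A at *
  generalize (Finset.univ.filter
    (fun v : Fin m => x (e (c, v)) = true ∧ y (e (c, v)) = true)).card = B at *
  generalize (Finset.univ.filter
    (fun v : Fin m => y (e (c, v)) = true ∧ x (e (c, v)) = false)).card = D at *
  have hm' : (0:ℝ) < m := by exact_mod_cast hm
  have h6 : (A:ℝ) = B + D := by exact_mod_cast h4
  have h7 : (A:ℝ) ≤ m := by exact_mod_cast h5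
  have h8 := Real.add_one_le_exp (-(D:ℝ)/m)
  have h9 : (B:ℝ) ≤ (-(D:ℝ)/m + 1) * A := by
    have : (A:ℝ)/m ≤ 1 := by rw [div_le_one hm']; exact h7
    have hD : (0:ℝ) ≤ D := by positivity
    have : (D:ℝ) * (A/m) ≤ D * 1 := by gcongr
    have : (-(D:ℝ)/m + 1) * A = A - D * (A/m) := by ring
    linarith
  exact h9.trans (by gcongr)

open Classical in
lemma pair_T {m n N : ℕ} (e : Fin m × Fin m → Fin n) (x y : Fin n → Bool) (hm : 0 < m) :
    ((Finset.univ.filter (fun T : Fin N → Fin m → Fin m =>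
        ∃ i, SS e T x = {i} ∧ SS e T y = {i})).card : ℝ) ≤
      Real.exp (-(dp e x y : ℝ) / m) * (Fintype.card (Fin N → Fin m → Fin m) : ℝ) := by
  let B : Finset (Fin m → Fin m) := Finset.univ.filter (fun t => Sat e t y)
  let A : Finset (Fin m → Fin m) := Finset.univ.filter (fun t => Sat e t x ∧ Sat e t y)
  let P : Finset (Fin m → Fin m) → Fin N → Finset (Fin N → Fin m → Fin m) := fun C i =>
    Fintype.piFinset (fun j => if j = i then C else Bᶜ)
  have hP : ∀ i, ((P A i).card : ℝ) ≤ Real.exp (-(dp e x y : ℝ) / m) * ((P B i).card : ℝ) := by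
    intro i
    simp only [P, Fintype.card_piFinset]
    rw [← Finset.mul_prod_erase _ _ (Finset.mem_univ i),
      ← Finset.mul_prod_erase (a := i) (s := Finset.univ) (f := fun j => (if j = i then B else Bᶜ).card) (h := Finset.mem_univ i)]
    have : ∏ j ∈ Finset.univ.erase i, (if j = i then A else Bᶜ).card =
        ∏ j ∈ Finset.univ.erase i, (if j = i then B else Bᶜ).card := by
      refine Finset.prod_congr rfl ?_
      intro j hj
      rw [if_neg (Finset.ne_of_mem_erase hj), if_neg (Finset.ne_of_mem_erase hj)]
    rw [this]
    generalize (∏ j ∈ Finset.univ.erase i, (if j = i then B else Bᶜ).card) = R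
    rw [if_pos rfl, if_pos rfl, Nat.cast_mul, Nat.cast_mul, ← mul_assoc]
    exact mul_le_mul_of_nonneg_right (sat_card e x y hm) (Nat.cast_nonneg R)
  have hsub : (Finset.univ.filter (fun T : Fin N → Fin m → Fin m =>
        ∃ i, SS e T x = {i} ∧ SS e T y = {i})) ⊆ Finset.univ.biUnion (P A) := by
    intro T hT
    simp only [Finset.mem_filter, Finset.mem_univ, true_and] at hT
    obtain ⟨i, h1, h2⟩ := hT
    simp only [Finset.mem_biUnion, Finset.mem_univ, true_and, P, Fintype.mem_piFinset]
    refine ⟨i, fun j => ?_⟩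
    have a1 := Finset.ext_iff.mp h1 j
    have a2 := Finset.ext_iff.mp h2 j
    rw [mem_SS, Finset.mem_singleton] at a1 a2
    by_cases hj : j = i
    · rw [if_pos hj]
      exact Finset.mem_filter.mpr ⟨Finset.mem_univ _, a1.mpr hj, a2.mpr hj⟩
    · rw [if_neg hj, Finset.mem_compl]
      intro h
      exact hj (a2.mp (Finset.mem_filter.mp h).2)
  have hdisj : ∀ i ∈ (Finset.univ : Finset (Fin N)), ∀ j ∈ (Finset.univ : Finset (Fin N)), i ≠ j →
      Disjoint (P B i) (P B j) := by
    intro i _ j _ hij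
    rw [Finset.disjoint_left]
    intro T h1 h2
    simp only [P, Fintype.mem_piFinset] at h1 h2
    have a1 := h1 i
    have a2 := h2 i
    rw [if_pos rfl] at a1
    rw [if_neg hij, Finset.mem_compl] at a2
    exact a2 a1
  calc _ ≤ ((Finset.univ.biUnion (P A)).card : ℝ) := by exact_mod_cast Finset.card_le_card hsub
    _ ≤ ∑ i, ((P A i).card : ℝ) := by exact_mod_cast Finset.card_biUnion_le
    _ ≤ ∑ i, Real.exp (-(dp e x y : ℝ) / m) * ((P B i).card : ℝ) :=
        Finset.sum_le_sum (fun i _ => hP i)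
    _ = Real.exp (-(dp e x y : ℝ) / m) * ((Finset.univ.biUnion (P B)).card : ℝ) := by
        rw [Finset.card_biUnion hdisj, ← Finset.mul_sum]; push_cast; rfl
    _ ≤ _ := by
        gcongr
        exact Finset.card_le_univ _

open Classical in
lemma pair_k {m n N : ℕ} (e : Fin m × Fin m → Fin n) (x y : Fin n → Bool) (hm : 0 < m) :
    ((Finset.univ.filter (fun T : Fin N → Fin m → Fin m =>
        ∃ i, SS e T x = {i} ∧ SS e T y = {i})).card : ℝ) *
    ((Finset.univ.filter (fun k : Fin m × Fin m => x (e k) ≠ y (e k))).card : ℝ) ≤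
      2 * m * (Fintype.card (Fin N → Fin m → Fin m) : ℝ) := by
  have h1 := pair_T (N := N) e x y hm
  have h2 := pair_T (N := N) e y x hm
  have h3 : (Finset.univ.filter (fun T : Fin N → Fin m → Fin m =>
        ∃ i, SS e T y = {i} ∧ SS e T x = {i})) = (Finset.univ.filter (fun T : Fin N → Fin m → Fin m =>
        ∃ i, SS e T x = {i} ∧ SS e T y = {i})) := by
    simp only [and_comm]
  rw [h3] at h2
  have h4 : (Finset.univ.filter (fun k : Fin m × Fin m => x (e k) ≠ y (e k))).card =
      dp e x y + dp e y x := by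
    unfold dp
    rw [← Finset.card_union_of_disjoint]
    · congr 1; ext v; simp only [Finset.mem_filter, Finset.mem_union, Finset.mem_univ, true_and]
      cases x (e v) <;> cases y (e v) <;> simp
    · rw [Finset.disjoint_filter]; intro v _ h h'; simp_all
  rw [h4]
  push_cast
  generalize ((Finset.univ.filter (fun T : Fin N → Fin m → Fin m =>
        ∃ i, SS e T x = {i} ∧ SS e T y = {i})).card : ℝ) = C at *
  have hW : (0:ℝ) ≤ (Fintype.card (Fin N → Fin m → Fin m) : ℝ) := by positivity
  generalize (Fintype.card (Fin N → Fin m → Fin m) : ℝ) = W at *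
  have hm' : (0:ℝ) < m := by exact_mod_cast hm
  have key : ∀ d : ℝ, 0 ≤ d → C ≤ Real.exp (-d / m) * W → C * d ≤ m * W := by
    intro d hd hC
    have a1 : d / m ≤ Real.exp (d/m) := by linarith [Real.add_one_le_exp (d/m)]
    have a2 : Real.exp (-d/m) * Real.exp (d/m) = 1 := by
      rw [← Real.exp_add]; simp [neg_div]
    have a3 : Real.exp (-d/m) * (d/m) ≤ 1 := by
      rw [← a2]; gcongr
    calc C * d ≤ Real.exp (-d / m) * W * d := by gcongr
      _ = (Real.exp (-d/m) * (d/m)) * (m * W) := by field_simp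
      _ ≤ 1 * (m * W) := by gcongr
      _ = _ := one_mul _
  have k1 := key _ (by positivity) h1
  have k2 := key _ (by positivity) h2
  linarith

open Classical in
lemma bad_count {m n N q : ℕ} (e : Fin m × Fin m → Fin n) (Q : Fin q → Fin n → Bool)
    (hm : 0 < m) :
    (∑ T : Fin N → Fin m → Fin m, ∑ k : Fin m × Fin m, ∑ l : Fin m × Fin m,
      if Bad e Q T k l then (1:ℝ) else 0) ≤
      4 * q ^ 2 * m ^ 3 * (Fintype.card (Fin N → Fin m → Fin m) : ℝ) := by
  have hpt : ∀ (T : Fin N → Fin m → Fin m) (k l : Fin m × Fin m),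
      (if Bad e Q T k l then (1:ℝ) else 0) ≤ ∑ a, ∑ a',
        (if (∃ i, SS e T (Q a) = {i} ∧ SS e T (Q a') = {i}) then (1:ℝ) else 0) *
        ((if Q a (e k) ≠ Q a' (e k) then 1 else 0) + (if Q a (e l) ≠ Q a' (e l) then 1 else 0)) := by
    intro T k l
    have hnn : ∀ a a', (0:ℝ) ≤ (if (∃ i, SS e T (Q a) = {i} ∧ SS e T (Q a') = {i}) then (1:ℝ) else 0) *
        ((if Q a (e k) ≠ Q a' (e k) then 1 else 0) + (if Q a (e l) ≠ Q a' (e l) then 1 else 0)) := by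
      intro a a'; positivity
    split_ifs with hB
    · obtain ⟨a, a', h1, h2⟩ := hB
      refine le_trans ?_ (Finset.single_le_sum (f := fun a => ∑ a',
        (if (∃ i, SS e T (Q a) = {i} ∧ SS e T (Q a') = {i}) then (1:ℝ) else 0) *
        ((if Q a (e k) ≠ Q a' (e k) then 1 else 0) + (if Q a (e l) ≠ Q a' (e l) then 1 else 0)))
        (fun a _ => Finset.sum_nonneg (fun a' _ => hnn a a')) (Finset.mem_univ a))
      refine le_trans ?_ (Finset.single_le_sum (fun a' _ => hnn a a') (Finset.mem_univ a'))
      rw [if_pos h1, one_mul]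
      by_cases hk : Q a (e k) = Q a' (e k)
      · have hl : Q a (e l) ≠ Q a' (e l) := by
          intro hl; apply h2; simp [zz, hk, hl]
        simp [hk, hl]
      · rw [if_pos hk]
        have : (0:ℝ) ≤ if Q a (e l) ≠ Q a' (e l) then 1 else 0 := by positivity
        linarith
    · exact Finset.sum_nonneg (fun a _ => Finset.sum_nonneg (fun a' _ => hnn a a'))
  have hpair : ∀ a a' : Fin q, (∑ T : Fin N → Fin m → Fin m, ∑ k : Fin m × Fin m, ∑ l : Fin m × Fin m,
      (if (∃ i, SS e T (Q a) = {i} ∧ SS e T (Q a') = {i}) then (1:ℝ) else 0) *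
        ((if Q a (e k) ≠ Q a' (e k) then 1 else 0) + (if Q a (e l) ≠ Q a' (e l) then 1 else 0))) ≤
      4 * m ^ 3 * (Fintype.card (Fin N → Fin m → Fin m) : ℝ) := by
    intro a a'
    have h := pair_k (N := N) e (Q a) (Q a') hm
    rw [Finset.card_filter, Finset.card_filter] at h
    push_cast at h
    set D : ℝ := ∑ k : Fin m × Fin m, (if Q a (e k) ≠ Q a' (e k) then (1:ℝ) else 0) with hD
    have : ∀ T : Fin N → Fin m → Fin m, (∑ k : Fin m × Fin m, ∑ l : Fin m × Fin m,
      (if (∃ i, SS e T (Q a) = {i} ∧ SS e T (Q a') = {i}) then (1:ℝ) else 0) *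
        ((if Q a (e k) ≠ Q a' (e k) then 1 else 0) + (if Q a (e l) ≠ Q a' (e l) then 1 else 0))) =
        (if (∃ i, SS e T (Q a) = {i} ∧ SS e T (Q a') = {i}) then (1:ℝ) else 0) * (2 * m^2 * D) := by
      intro T
      simp_rw [← Finset.mul_sum, Finset.sum_add_distrib, Finset.sum_const, ← hD]
      rw [← Finset.smul_sum, ← hD]
      simp [Finset.card_univ]
      split_ifs <;> ring
    simp_rw [this]
    rw [← Finset.sum_mul]
    calc _ = 2 * (m:ℝ)^2 * ((∑ T : Fin N → Fin m → Fin m, (if (∃ i, SS e T (Q a) = {i} ∧ SS e T (Q a') = {i}) then (1:ℝ) else 0)) * D) := by ring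
      _ ≤ 2 * (m:ℝ)^2 * (2 * m * (Fintype.card (Fin N → Fin m → Fin m) : ℝ)) := by
          refine mul_le_mul_of_nonneg_left ?_ (by positivity)
          convert h using 2
      _ = _ := by ring
  calc _ ≤ ∑ T : Fin N → Fin m → Fin m, ∑ k : Fin m × Fin m, ∑ l : Fin m × Fin m, ∑ a, ∑ a',
        (if (∃ i, SS e T (Q a) = {i} ∧ SS e T (Q a') = {i}) then (1:ℝ) else 0) *
        ((if Q a (e k) ≠ Q a' (e k) then 1 else 0) + (if Q a (e l) ≠ Q a' (e l) then 1 else 0)) :=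
        Finset.sum_le_sum (fun T _ => Finset.sum_le_sum (fun k _ => Finset.sum_le_sum (fun l _ => hpt T k l)))
    _ = ∑ a, ∑ a', ∑ T : Fin N → Fin m → Fin m, ∑ k : Fin m × Fin m, ∑ l : Fin m × Fin m,
        (if (∃ i, SS e T (Q a) = {i} ∧ SS e T (Q a') = {i}) then (1:ℝ) else 0) *
        ((if Q a (e k) ≠ Q a' (e k) then 1 else 0) + (if Q a (e l) ≠ Q a' (e l) then 1 else 0)) := by
        have sw : ∀ G : (Fin N → Fin m → Fin m) → (Fin m × Fin m) → (Fin m × Fin m) → Fin q → ℝ,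
            ∑ T, ∑ k, ∑ l, ∑ a, G T k l a = ∑ a, ∑ T, ∑ k, ∑ l, G T k l a := by
          intro G
          conv_rhs => rw [Finset.sum_comm]
          refine Finset.sum_congr rfl (fun T _ => ?_)
          conv_rhs => rw [Finset.sum_comm]
          refine Finset.sum_congr rfl (fun k _ => ?_)
          rw [Finset.sum_comm]
        rw [sw]
        refine Finset.sum_congr rfl (fun a _ => ?_)
        rw [sw]
    _ ≤ ∑ a : Fin q, ∑ a' : Fin q, 4 * m ^ 3 * (Fintype.card (Fin N → Fin m → Fin m) : ℝ) :=
        Finset.sum_le_sum (fun a _ => Finset.sum_le_sum (fun a' _ => hpair a a'))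
    _ = _ := by simp; ring

lemma subcube_card {n : ℕ} (S : Finset (Fin n)) (v : Fin n → Bool) :
    ((Finset.univ.filter (fun x : Fin n → Bool => ∀ j ∈ S, x j = v j)).card : ℝ) * 2 ^ S.card
      = 2 ^ n := by
  have h1 : (Finset.univ.filter (fun x : Fin n → Bool => ∀ j ∈ S, x j = v j)) =
      Fintype.piFinset (fun j => if j ∈ S then {v j} else Finset.univ) := by
    ext x
    simp only [Finset.mem_filter, Finset.mem_univ, true_and, Fintype.mem_piFinset]
    refine forall_congr' (fun j => ?_)
    by_cases hj : j ∈ S <;> simp [hj]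
  rw [h1, Fintype.card_piFinset]
  have h2 : (2:ℝ) ^ S.card = ∏ j : Fin n, if j ∈ S then (2:ℝ) else 1 := by
    rw [Finset.prod_ite_mem]; simp
  rw [h2]
  push_cast
  rw [← Finset.prod_mul_distrib]
  have : ∀ j ∈ (Finset.univ : Finset (Fin n)), ((if j ∈ S then {v j} else Finset.univ : Finset Bool).card : ℝ) *
      (if j ∈ S then (2:ℝ) else 1) = 2 := by
    intro j _
    by_cases hj : j ∈ S <;> simp [hj]
  rw [Finset.prod_congr rfl this]
  simp

/-- Coordinates of a term. -/
def TS {m n : ℕ} (e : Fin m × Fin m → Fin n) (t : Fin m → Fin m) : Finset (Fin n) :=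
  Finset.univ.image (fun c => e (c, t c))

lemma TS_card {m n : ℕ} (e : Fin m × Fin m → Fin n) (he : Function.Injective e)
    (t : Fin m → Fin m) : (TS e t).card = m := by
  unfold TS
  rw [Finset.card_image_of_injective]
  · simp
  · intro a b h; exact (Prod.ext_iff.mp (he h)).1

lemma sat_iff {m n : ℕ} (e : Fin m × Fin m → Fin n) (t : Fin m → Fin m) (x : Fin n → Bool) :
    Sat e t x ↔ ∀ j ∈ TS e t, x j = true := by
  simp [Sat, TS]

/-- Number of agreements. -/
def agr {m : ℕ} (s t : Fin m → Fin m) : ℕ := (Finset.univ.filter (fun c => s c = t c)).card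

open Classical in
lemma joint_card {m n : ℕ} (e : Fin m × Fin m → Fin n) (he : Function.Injective e)
    (s t : Fin m → Fin m) (k : Fin m × Fin m) :
    ((Finset.univ.filter (fun x : Fin n → Bool =>
      Sat e s x ∧ Sat e t (Function.update x (e k) true))).card : ℝ) ≤
      2 ^ n * (2 * 2 ^ agr s t / 4 ^ m) := by
  let S : Finset (Fin n) := TS e s ∪ (TS e t).erase (e k)
  have hsub : (Finset.univ.filter (fun x : Fin n → Bool =>
      Sat e s x ∧ Sat e t (Function.update x (e k) true))) ⊆
      (Finset.univ.filter (fun x : Fin n → Bool => ∀ j ∈ S, x j = (fun _ => true) j)) := by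
    intro x hx
    simp only [Finset.mem_filter, Finset.mem_univ, true_and] at *
    rw [sat_iff, sat_iff] at hx
    intro j hj
    simp only [S, Finset.mem_union, Finset.mem_erase] at hj
    rcases hj with hj | ⟨h1, h2⟩
    · exact hx.1 j hj
    · have := hx.2 j h2
      rwa [Function.update_of_ne h1] at this
  have hS : 2 * m ≤ S.card + (agr s t + 1) := by
    have h1 : (TS e s ∩ TS e t).card ≤ agr s t := by
      have : TS e s ∩ TS e t ⊆ (Finset.univ.filter (fun c => s c = t c)).image (fun c => e (c, t c)) := by
        intro j hj
        simp only [TS, Finset.mem_inter, Finset.mem_image, Finset.mem_univ, true_and] at hj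
        obtain ⟨⟨a, ha⟩, ⟨b, hb⟩⟩ := hj
        have := he (ha.trans hb.symm)
        rw [Prod.mk.injEq] at this
        obtain ⟨rfl, h⟩ := this
        simp only [Finset.mem_image, Finset.mem_filter, Finset.mem_univ, true_and]
        exact ⟨a, h, hb⟩
      exact (Finset.card_le_card this).trans Finset.card_image_le
    have h2 := Finset.card_union_add_card_inter (TS e s) ((TS e t).erase (e k))
    have h3 : (TS e s ∩ (TS e t).erase (e k)).card ≤ (TS e s ∩ TS e t).card :=
      Finset.card_le_card (Finset.inter_subset_inter_left (Finset.erase_subset _ _))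
    have h4 := Finset.pred_card_le_card_erase (s := TS e t) (a := e k)
    rw [TS_card e he] at h2 h4
    simp only [S]
    omega
  have hc := subcube_card S (fun _ => true)
  have hle : ((Finset.univ.filter (fun x : Fin n → Bool =>
      Sat e s x ∧ Sat e t (Function.update x (e k) true))).card : ℝ) ≤
      ((Finset.univ.filter (fun x : Fin n → Bool => ∀ j ∈ S, x j = (fun _ => true) j)).card : ℝ) := by
    exact_mod_cast Finset.card_le_card hsub
  refine hle.trans ?_
  generalize ((Finset.univ.filter (fun x : Fin n → Bool => ∀ j ∈ S, x j = (fun _ => true) j)).card : ℝ) = X at *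
  have h5 : (4:ℝ)^m ≤ 2 ^ S.card * (2 * 2 ^ agr s t) := by
    calc (4:ℝ)^m = 2^(2*m) := by rw [pow_mul]; norm_num
      _ ≤ 2 ^ (S.card + (agr s t + 1)) := by gcongr; norm_num
      _ = _ := by ring
  rw [← hc, ← mul_div_assoc, le_div_iff₀ (by positivity)]
  have hX : 0 ≤ X := by
    by_contra h
    have : X * 2 ^ S.card < 0 := mul_neg_of_neg_of_pos (by linarith) (by positivity)
    rw [hc] at this
    have : (0:ℝ) < 2^n := by positivity
    linarith
  calc X * 4^m ≤ X * (2 ^ S.card * (2 * 2 ^ agr s t)) := by gcongr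
    _ = _ := by ring

lemma c_card {m n : ℕ} (e : Fin m × Fin m → Fin n) (he : Function.Injective e)
    (t : Fin m → Fin m) (k l : Fin m × Fin m) (hk : t k.1 ≠ k.2) (hl : t l.1 ≠ l.2) (hkl : k ≠ l)
    (b : Bool) [DecidablePred (fun x : Fin n → Bool =>
      Sat e t x ∧ x (e k) = false ∧ x (e l) = (!b) ∧ k ≠ l)] :
    (2:ℝ) ^ n * (1 / 2 ^ (m+2)) ≤ ((Finset.univ.filter (fun x : Fin n → Bool =>
      Sat e t x ∧ x (e k) = false ∧ x (e l) = (!b) ∧ k ≠ l)).card : ℝ) := by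
  classical
  let S : Finset (Fin n) := insert (e k) (insert (e l) (TS e t))
  let v : Fin n → Bool := fun j => if j = e k then false else if j = e l then !b else true
  have hkl' : e l ≠ e k := fun h => hkl (he h).symm
  have hsub : (Finset.univ.filter (fun x : Fin n → Bool => ∀ j ∈ S, x j = v j)) ⊆
      (Finset.univ.filter (fun x : Fin n → Bool =>
      Sat e t x ∧ x (e k) = false ∧ x (e l) = (!b) ∧ k ≠ l)) := by
    intro x hx
    simp only [Finset.mem_filter, Finset.mem_univ, true_and] at *
    refine ⟨?_, ?_, ?_, hkl⟩
    · intro c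
      have h1 : e (c, t c) ≠ e k := by
        intro h; apply hk; rw [← he h]
      have h2 : e (c, t c) ≠ e l := by
        intro h; apply hl; rw [← he h]
      rw [hx _ (by simp [S, TS])]
      simp [v, h1, h2]
    · rw [hx _ (by simp [S])]; simp [v]
    · rw [hx _ (by simp [S])]; simp [v, hkl']
  have hS : S.card ≤ m + 2 := by
    have h1 := Finset.card_insert_le (e k) (insert (e l) (TS e t))
    have h2 := Finset.card_insert_le (e l) (TS e t)
    rw [TS_card e he] at h2
    simp only [S]; omega
  have hc := subcube_card S v
  have hle : ((Finset.univ.filter (fun x : Fin n → Bool => ∀ j ∈ S, x j = v j)).card : ℝ) ≤ _ :=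
    Nat.cast_le.mpr (Finset.card_le_card hsub)
  refine le_trans ?_ hle
  rw [← hc, mul_assoc]
  refine mul_le_of_le_one_right (by positivity) ?_
  rw [mul_one_div, div_le_one (by positivity)]
  gcongr
  norm_num

open Classical in
/-- The deficit. -/
noncomputable def YY {m N : ℕ} (T : Fin N → Fin m → Fin m) (k l : Fin m × Fin m) : ℝ :=
  ∑ i, (if T i k.1 = k.2 ∨ T i l.1 = l.2 ∨ k = l then (1:ℝ) else 0) * (1 / 2 ^ (m+2)) +
  ∑ i, ∑ j, if j = i then (0:ℝ) else 2 * 2 ^ agr (T i) (T j) / 4 ^ m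

lemma FF_single {m n N : ℕ} (e : Fin m × Fin m → Fin n) (T : Fin N → Fin m → Fin m)
    (h : Fin N → Bool) (x : Fin n → Bool) (i : Fin N) (hi : SS e T x = {i}) :
    FF e T h x = h i := by
  simp [FF, hi]

lemma dist_lower {m n N : ℕ} (e : Fin m × Fin m → Fin n) (he : Function.Injective e)
    (T : Fin N → Fin m → Fin m) (b : Fin N → Bool) (k l : Fin m × Fin m)
    (g : (Fin n → Bool) → Bool) (hg : IsMono g) :
    N * (1 / 2 ^ (m+2)) - YY T k l ≤ distB (FN e T b k l) g := by
  classical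
  let up : (Fin n → Bool) → (Fin n → Bool) := fun x => Function.update x (e k) true
  let C : Fin N → Finset (Fin n → Bool) := fun i => Finset.univ.filter (fun x =>
      Sat e (T i) x ∧ x (e k) = false ∧ x (e l) = (!(b i)) ∧ k ≠ l)
  let V : Fin N → Finset (Fin n → Bool) := fun i => (C i).filter (fun x =>
      ∀ j, j ≠ i → ¬ Sat e (T j) (up x))
  let J : Fin N → Fin N → Finset (Fin n → Bool) := fun i j => Finset.univ.filter (fun x =>
      Sat e (T i) x ∧ Sat e (T j) (up x))
  let D : Finset (Fin n → Bool) := Finset.univ.filter (fun x => FN e T b k l x ≠ g x)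
  have hup : ∀ x, x ≤ up x := by
    intro x j
    simp only [up]
    by_cases hj : j = e k
    · subst hj; simp [Bool.le_true]
    · rw [Function.update_of_ne hj]
  have hsatup : ∀ t x, Sat e t x → Sat e t (up x) := by
    intro t x h c
    exact Bool.le_iff_imp.mp (hup x _) (h c)
  have hC : ∀ i, (2:ℝ)^n * ((1 / 2^(m+2)) - (if T i k.1 = k.2 ∨ T i l.1 = l.2 ∨ k = l then (1:ℝ) else 0) * (1 / 2 ^ (m+2))) ≤ ((C i).card : ℝ) := by
    intro i
    split_ifs with h
    · simp
    · push Not at h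
      simpa using c_card e he (T i) k l h.1 h.2.1 h.2.2 (b i)
  have hCV : ∀ i, ((C i).card : ℝ) ≤ (V i).card + ∑ j, if j = i then (0:ℝ) else ((J i j).card : ℝ) := by
    intro i
    have hsub : C i ⊆ V i ∪ (Finset.univ.erase i).biUnion (J i) := by
      intro x hx
      rw [Finset.mem_union]
      by_cases hV : ∀ j, j ≠ i → ¬ Sat e (T j) (up x)
      · left; exact Finset.mem_filter.mpr ⟨hx, hV⟩
      · right
        push Not at hV
        obtain ⟨j, h1, h2⟩ := hV
        exact Finset.mem_biUnion.mpr ⟨j, Finset.mem_erase.mpr ⟨h1, Finset.mem_univ _⟩,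
          Finset.mem_filter.mpr ⟨Finset.mem_univ _, (Finset.mem_filter.mp hx).2.1, h2⟩⟩
    have h1 := (Finset.card_le_card hsub).trans (Finset.card_union_le _ _)
    have h2 : ((Finset.univ.erase i).biUnion (J i)).card ≤ ∑ j ∈ Finset.univ.erase i, (J i j).card :=
      Finset.card_biUnion_le
    have h3 : (∑ j, if j = i then (0:ℝ) else ((J i j).card : ℝ)) = ∑ j ∈ Finset.univ.erase i, ((J i j).card : ℝ) := by
      rw [← Finset.add_sum_erase _ _ (Finset.mem_univ i)]
      rw [if_pos rfl, zero_add]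
      exact Finset.sum_congr rfl (fun j hj => if_neg (Finset.ne_of_mem_erase hj))
    rw [h3]
    exact_mod_cast h1.trans (Nat.add_le_add_left h2 _)
  have hJ : ∀ i j, ((J i j).card : ℝ) ≤ 2 ^ n * (2 * 2 ^ agr (T i) (T j) / 4 ^ m) := by
    intro i j
    convert joint_card e he (T i) (T j) k
  have hdisj : ∀ i ∈ (Finset.univ : Finset (Fin N)), ∀ j ∈ (Finset.univ : Finset (Fin N)), i ≠ j →
      Disjoint (V i) (V j) := by
    intro i _ j _ hij
    rw [Finset.disjoint_left]
    intro x h1 h2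
    have a1 := (Finset.mem_filter.mp (Finset.mem_filter.mp h1).1).2.1
    exact (Finset.mem_filter.mp h2).2 i hij (hsatup _ _ a1)
  have hviol : ∀ x ∈ Finset.univ.biUnion V, x (e k) = false ∧ FN e T b k l x = true ∧
      FN e T b k l (up x) = false := by
    intro x hx
    obtain ⟨i, _, hi⟩ := Finset.mem_biUnion.mp hx
    obtain ⟨hCi, hV⟩ := Finset.mem_filter.mp hi
    obtain ⟨_, hs, hk, hl, hkl⟩ := Finset.mem_filter.mp hCi
    have hne : e l ≠ e k := fun h => hkl (he h).symm
    have s1 : SS e T x = {i} := by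
      ext j; rw [mem_SS, Finset.mem_singleton]
      constructor
      · intro h; by_contra hj; exact hV j hj (hsatup _ _ h)
      · rintro rfl; exact hs
    have s2 : SS e T (up x) = {i} := by
      ext j; rw [mem_SS, Finset.mem_singleton]
      constructor
      · intro h; by_contra hj; exact hV j hj h
      · rintro rfl; exact hsatup _ _ hs
    have u1 : up x (e k) = true := by simp [up]
    have u2 : up x (e l) = !(b i) := by simp only [up]; rw [Function.update_of_ne hne, hl]
    refine ⟨hk, ?_, ?_⟩
    · rw [FN, FF_single _ _ _ _ _ s1]; simp [zz, hk, hl]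
    · rw [FN, FF_single _ _ _ _ _ s2]; simp [zz, u1, u2]
  have hVD : (Finset.univ.biUnion V).card ≤ D.card := by
    refine Finset.card_le_card_of_injOn (fun x => if FN e T b k l x ≠ g x then x else up x) ?_ ?_
    · intro x hx
      obtain ⟨h1, h2, h3⟩ := hviol x hx
      refine Finset.mem_coe.mpr (Finset.mem_filter.mpr ⟨Finset.mem_univ _, ?_⟩)
      simp only
      by_cases h : FN e T b k l x ≠ g x
      · rw [if_pos h]; exact h
      · rw [if_neg h]
        push Not at h
        rw [h3]
        have := Bool.le_iff_imp.mp (hg x (up x) (hup x)) (by rw [← h, h2])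
        rw [this]; simp
    · intro x hx y hy hxy
      have h1 := (hviol x hx).1
      have h2 := (hviol y hy).1
      have hrec : ∀ z : Fin n → Bool, z (e k) = false →
          Function.update (if FN e T b k l z ≠ g z then z else up z) (e k) false = z := by
        intro z hz
        split_ifs
        · rw [← hz, Function.update_eq_self]
        · simp only [up, Function.update_idem]; rw [← hz, Function.update_eq_self]
      rw [← hrec x h1, ← hrec y h2]
      simp only at hxy
      rw [hxy]
  have htot : (2:ℝ)^n * (N * (1 / 2 ^ (m+2)) - YY T k l) ≤ D.card := by
    calc (2:ℝ)^n * (N * (1 / 2 ^ (m+2)) - YY T k l) =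
        ∑ i, ((2:ℝ)^n * ((1 / 2^(m+2)) - (if T i k.1 = k.2 ∨ T i l.1 = l.2 ∨ k = l then (1:ℝ) else 0) * (1 / 2 ^ (m+2))) - ∑ j, if j = i then (0:ℝ) else (2 ^ n * (2 * 2 ^ agr (T i) (T j) / 4 ^ m))) := by
          rw [Finset.sum_sub_distrib, ← Finset.mul_sum, Finset.sum_sub_distrib]
          have : ∀ i j : Fin N, (if j = i then (0:ℝ) else (2 ^ n * (2 * 2 ^ agr (T i) (T j) / 4 ^ m))) =
            2^n * (if j = i then (0:ℝ) else (2 * 2 ^ agr (T i) (T j) / 4 ^ m)) := by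
            intro i j; split_ifs <;> simp
          simp_rw [this, ← Finset.mul_sum]
          rw [← mul_sub, YY]
          congr 1
          rw [Finset.sum_const, Finset.card_univ, Fintype.card_fin, nsmul_eq_mul]
          ring
      _ ≤ ∑ i, ((V i).card : ℝ) := by
          refine Finset.sum_le_sum (fun i _ => ?_)
          have h1 := hC i
          have h2 := hCV i
          have h3 : (∑ j, if j = i then (0:ℝ) else ((J i j).card : ℝ)) ≤
            ∑ j, if j = i then (0:ℝ) else (2 ^ n * (2 * 2 ^ agr (T i) (T j) / 4 ^ m)) := by
            refine Finset.sum_le_sum (fun j _ => ?_)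
            split_ifs
            · exact le_refl _
            · exact hJ i j
          linarith
      _ = ((Finset.univ.biUnion V).card : ℝ) := by
          rw [Finset.card_biUnion hdisj]; push_cast; rfl
      _ ≤ D.card := by exact_mod_cast hVD
  unfold distB
  rw [le_div_iff₀ (by positivity)]
  have hcard : (Fintype.card (Fin n → Bool) : ℝ) = 2^n := by simp
  rw [hcard, mul_comm]
  convert htot

lemma sum_agr {m : ℕ} (hm : 0 < m) (s : Fin m → Fin m) :
    ∑ t : Fin m → Fin m, (2:ℝ) ^ agr s t ≤ 3 * (Fintype.card (Fin m → Fin m) : ℝ) := by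
  have h1 : ∀ t : Fin m → Fin m, (2:ℝ) ^ agr s t = ∏ c, (if s c = t c then (2:ℝ) else 1) := by
    intro t
    rw [agr, ← Finset.prod_filter]; simp
  simp_rw [h1]
  have h2 := Finset.prod_univ_sum (R := ℝ) (fun _ : Fin m => (Finset.univ : Finset (Fin m)))
    (fun c v => if s c = v then (2:ℝ) else 1)
  rw [Fintype.piFinset_univ] at h2
  rw [← h2]
  have h3 : ∀ c : Fin m, ∑ v : Fin m, (if s c = v then (2:ℝ) else 1) = m + 1 := by
    intro c
    have : ∀ v : Fin m, (if s c = v then (2:ℝ) else 1) = 1 + (if s c = v then (1:ℝ) else 0) := by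
      intro v; split_ifs <;> norm_num
    simp_rw [this, Finset.sum_add_distrib]
    simp
  simp_rw [h3]
  simp only [Finset.prod_const, Finset.card_univ, Fintype.card_fin, Fintype.card_fun, Nat.cast_pow]
  have hm' : (0:ℝ) < m := by exact_mod_cast hm
  have h4 : (m:ℝ) + 1 = m * (1/m + 1) := by field_simp; ring
  rw [h4, mul_pow, mul_comm]
  gcongr
  calc (1/(m:ℝ) + 1)^m ≤ (Real.exp (1/m))^m := by
        gcongr; exact Real.add_one_le_exp _
    _ = Real.exp 1 := by rw [← Real.exp_nat_mul]; congr 1; field_simp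
    _ ≤ 3 := by linarith [Real.exp_one_lt_d9]

lemma sum_T_agr {m N : ℕ} (hm : 0 < m) (i j : Fin N) (hij : i ≠ j) :
    ∑ T : Fin N → Fin m → Fin m, (2:ℝ) ^ agr (T i) (T j) ≤
      3 * (Fintype.card (Fin N → Fin m → Fin m) : ℝ) := by
  let E := Equiv.funSplitAt j (Fin m → Fin m)
  have h1 : ∑ T : Fin N → Fin m → Fin m, (2:ℝ) ^ agr (T i) (T j) =
      ∑ p : (Fin m → Fin m) × ({a // a ≠ j} → (Fin m → Fin m)), (2:ℝ) ^ agr (p.2 ⟨i, hij⟩) p.1 := by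
    refine Fintype.sum_equiv E _ _ ?_
    intro T; simp [E, Equiv.funSplitAt, Equiv.piSplitAt]
  have h2 : Fintype.card (Fin N → Fin m → Fin m) =
    Fintype.card (Fin m → Fin m) * Fintype.card ({a // a ≠ j} → (Fin m → Fin m)) := by
    rw [Fintype.card_congr E, Fintype.card_prod]
  rw [h1, h2, Fintype.sum_prod_type_right]
  refine (Finset.sum_le_sum (fun r _ => sum_agr hm (r ⟨i, hij⟩))).trans ?_
  rw [Finset.sum_const, nsmul_eq_mul, Finset.card_univ]
  push_cast
  apply le_of_eq; ring

lemma sum_YY {m N : ℕ} (hm : 0 < m) :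
    ∑ T : Fin N → Fin m → Fin m, ∑ k : Fin m × Fin m, ∑ l : Fin m × Fin m, YY T k l ≤
      (N * (1 / 2 ^ (m+2)) * (3 * m ^ 3) + m ^ 4 * (N ^ 2 * (6 / 4 ^ m))) *
        (Fintype.card (Fin N → Fin m → Fin m) : ℝ) := by
  classical
  have hm1 : (1:ℝ) ≤ m := by exact_mod_cast hm
  have hk : ∀ t : Fin m → Fin m, ∑ k : Fin m × Fin m, (if t k.1 = k.2 then (1:ℝ) else 0) = m := by
    intro t
    rw [Fintype.sum_prod_type]; simp
  have h1 : ∀ t : Fin m → Fin m, ∑ k : Fin m × Fin m, ∑ l : Fin m × Fin m,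
      (if t k.1 = k.2 ∨ t l.1 = l.2 ∨ k = l then (1:ℝ) else 0) ≤ 3 * m ^ 3 := by
    intro t
    calc _ ≤ ∑ k : Fin m × Fin m, ∑ l : Fin m × Fin m,
        ((if t k.1 = k.2 then (1:ℝ) else 0) + (if t l.1 = l.2 then (1:ℝ) else 0) + (if k = l then (1:ℝ) else 0)) := by
          refine Finset.sum_le_sum (fun k _ => Finset.sum_le_sum (fun l _ => ?_))
          by_cases a : t k.1 = k.2 <;> by_cases b : t l.1 = l.2 <;> by_cases c : k = l <;>
            simp only [a, b, c] <;> norm_num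
      _ = (m:ℝ)^2 * m + m^2 * m + m^2 := by
          simp_rw [Finset.sum_add_distrib, hk, Finset.sum_const]
          rw [← Finset.smul_sum, hk]
          simp [Finset.card_univ]
          ring
      _ ≤ _ := by nlinarith [mul_nonneg (sq_nonneg (m:ℝ)) (sub_nonneg.mpr hm1)]
  have e1 : ∀ T : Fin N → Fin m → Fin m, ∑ k : Fin m × Fin m, ∑ l : Fin m × Fin m, YY T k l ≤
      N * (1 / 2 ^ (m+2)) * (3 * m ^ 3) + m^4 * ∑ i, ∑ j, (if j = i then (0:ℝ) else 2 * 2 ^ agr (T i) (T j) / 4 ^ m) := by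
    intro T
    simp only [YY, Finset.sum_add_distrib]
    refine add_le_add ?_ ?_
    · have : ∑ k : Fin m × Fin m, ∑ l : Fin m × Fin m, ∑ i : Fin N, (if T i k.1 = k.2 ∨ T i l.1 = l.2 ∨ k = l then (1:ℝ) else 0) * (1 / 2 ^ (m+2)) =
        ∑ i : Fin N, (∑ k : Fin m × Fin m, ∑ l : Fin m × Fin m, (if T i k.1 = k.2 ∨ T i l.1 = l.2 ∨ k = l then (1:ℝ) else 0)) * (1 / 2 ^ (m+2)) := by
        simp_rw [Finset.sum_mul]
        conv_rhs => rw [Finset.sum_comm]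
        refine Finset.sum_congr rfl (fun k _ => ?_)
        rw [Finset.sum_comm]
      rw [this]
      calc _ ≤ ∑ i : Fin N, (3 * (m:ℝ)^3) * (1 / 2 ^ (m+2)) :=
            Finset.sum_le_sum (fun i _ => mul_le_mul_of_nonneg_right (h1 (T i)) (by positivity))
        _ = _ := by simp; ring
    · apply le_of_eq
      simp only [Finset.sum_const, Finset.card_univ, Fintype.card_prod, Fintype.card_fin, nsmul_eq_mul]
      push_cast; ring
  refine (Finset.sum_le_sum (fun T _ => e1 T)).trans ?_
  rw [Finset.sum_add_distrib, add_mul]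
  refine add_le_add (le_of_eq (by simp; ring)) ?_
  rw [← Finset.mul_sum, mul_assoc]
  refine mul_le_mul_of_nonneg_left ?_ (by positivity)
  rw [Finset.sum_comm]
  have e2 : ∀ i j : Fin N, ∑ T : Fin N → Fin m → Fin m, (if j = i then (0:ℝ) else 2 * 2 ^ agr (T i) (T j) / 4 ^ m) ≤
      6 / 4^m * (Fintype.card (Fin N → Fin m → Fin m) : ℝ) := by
    intro i j
    by_cases h : j = i
    · simp only [h, if_true, Finset.sum_const_zero]; positivity
    · simp only [h, if_false]
      have := sum_T_agr hm i j (Ne.symm h)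
      rw [← Finset.sum_div, ← Finset.mul_sum, div_mul_eq_mul_div]
      refine div_le_div_of_nonneg_right ?_ (by positivity)
      linarith
  calc _ ≤ ∑ i : Fin N, ∑ j : Fin N, 6 / 4^m * (Fintype.card (Fin N → Fin m → Fin m) : ℝ) := by
        refine Finset.sum_le_sum (fun i _ => ?_)
        rw [Finset.sum_comm]
        exact Finset.sum_le_sum (fun j _ => e2 i j)
    _ = _ := by simp only [Finset.sum_const, Finset.card_univ, Fintype.card_fin, nsmul_eq_mul]; ring

open Classical in
lemma notfar_count {m n N : ℕ} (e : Fin m × Fin m → Fin n) (he : Function.Injective e)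
    (hm : 100 ≤ m) (hN : (N:ℝ) * 1024 = 2 ^ m) :
    (∑ T : Fin N → Fin m → Fin m, ∑ k : Fin m × Fin m, ∑ l : Fin m × Fin m,
      if (1:ℝ)/2^13 ≤ YY T k l then (1:ℝ) else 0) ≤
      m ^ 4 / 6 * (Fintype.card (Fin N → Fin m → Fin m) : ℝ) := by
  have h0 := sum_YY (N := N) (m := m) (by omega)
  have hY : ∀ (T : Fin N → Fin m → Fin m) (k l : Fin m × Fin m), 0 ≤ YY T k l := by
    intro T k l
    unfold YY
    refine add_nonneg (Finset.sum_nonneg fun i _ => ?_)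
      (Finset.sum_nonneg fun i _ => Finset.sum_nonneg fun j _ => ?_)
    · split_ifs <;> positivity
    · split_ifs <;> positivity
  have h1 : ∀ (T : Fin N → Fin m → Fin m) (k l : Fin m × Fin m),
      (if (1:ℝ)/2^13 ≤ YY T k l then (1:ℝ) else 0) ≤ 2^13 * YY T k l := by
    intro T k l
    split_ifs with h
    · rw [div_le_iff₀ (by positivity)] at h; linarith
    · have := hY T k l; positivity
  have h2 : (∑ T : Fin N → Fin m → Fin m, ∑ k : Fin m × Fin m, ∑ l : Fin m × Fin m,
      if (1:ℝ)/2^13 ≤ YY T k l then (1:ℝ) else 0) ≤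
      2^13 * ∑ T : Fin N → Fin m → Fin m, ∑ k : Fin m × Fin m, ∑ l : Fin m × Fin m, YY T k l := by
    simp_rw [Finset.mul_sum]
    exact Finset.sum_le_sum (fun T _ => Finset.sum_le_sum (fun k _ => Finset.sum_le_sum (fun l _ => h1 T k l)))
  refine h2.trans ?_
  have a1 : (N:ℝ) * (1 / 2 ^ (m+2)) = 1 / 4096 := by
    rw [pow_add, ← hN]
    have : (N:ℝ) ≠ 0 := by
      intro h; rw [h] at hN
      have : (0:ℝ) < 2^m := by positivity
      linarith
    field_simp; norm_num
  have a2 : (N:ℝ)^2 * (6 / 4 ^ m) = 6 / 1048576 := by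
    have : (4:ℝ)^m = (N * 1024)^2 := by rw [hN, ← pow_mul, mul_comm, pow_mul]; norm_num
    rw [this]
    have : (N:ℝ) ≠ 0 := by
      intro h; rw [h] at hN
      have : (0:ℝ) < 2^m := by positivity
      linarith
    field_simp; norm_num
  rw [a1, a2] at h0
  have hm' : (100:ℝ) ≤ m := by exact_mod_cast hm
  have h3 : (m:ℝ)^3 * 100 ≤ m^4 := by
    rw [pow_succ (m:ℝ) 3]; gcongr
  have hW : (0:ℝ) ≤ (Fintype.card (Fin N → Fin m → Fin m) : ℝ) := by positivity
  calc _ ≤ 2^13 * ((1 / 4096 * (3 * (m:ℝ) ^ 3) + m ^ 4 * (6 / 1048576)) *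
        (Fintype.card (Fin N → Fin m → Fin m) : ℝ)) := by gcongr
    _ = (2^13 * (1 / 4096 * (3 * (m:ℝ) ^ 3) + m ^ 4 * (6 / 1048576))) *
        (Fintype.card (Fin N → Fin m → Fin m) : ℝ) := by ring
    _ ≤ _ := by
      refine mul_le_mul_of_nonneg_right ?_ hW
      have : (0:ℝ) ≤ (m:ℝ)^4 := by positivity
      nlinarith

lemma FN_far {m n N : ℕ} (e : Fin m × Fin m → Fin n) (he : Function.Injective e)
    (hN : (N:ℝ) * 1024 = 2 ^ m) (T : Fin N → Fin m → Fin m) (b : Fin N → Bool)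
    (k l : Fin m × Fin m) (h : ¬ ((1:ℝ)/2^13 ≤ YY T k l)) :
    FarFromMono ((1:ℝ)/2^14) (FN e T b k l) := by
  intro g hg
  have h1 := dist_lower e he T b k l g hg
  have a1 : (N:ℝ) * (1 / 2 ^ (m+2)) = 1 / 4096 := by
    rw [pow_add, ← hN]
    have : (N:ℝ) ≠ 0 := by
      intro h; rw [h] at hN
      have : (0:ℝ) < 2^m := by positivity
      linarith
    field_simp; norm_num
  rw [a1] at h1
  push Not at h
  norm_num at h ⊢
  linarith

lemma main_bound {m n N q : ℕ} (e : Fin m × Fin m → Fin n) (he : Function.Injective e)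
    (hm : 100 ≤ m) (hN : (N:ℝ) * 1024 = 2 ^ m)
    (μ : (Fin q → (Fin n → Bool)) × ((Fin q → Bool) → Bool) → ℝ)
    (h0 : ∀ p, 0 ≤ μ p)
    (h1 : (∑ p : (Fin q → (Fin n → Bool)) × ((Fin q → Bool) → Bool), μ p) = 1)
    (hyes : ∀ f : (Fin n → Bool) → Bool, IsMono f → 2/3 ≤ acceptProb μ f)
    (hno : ∀ f : (Fin n → Bool) → Bool, FarFromMono ((1:ℝ)/2^14) f → acceptProb μ f ≤ 1/3) :
    (m:ℝ) ≤ 24 * q ^ 2 := by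
  classical
  let g : ((Fin q → (Fin n → Bool)) × ((Fin q → Bool) → Bool)) → (Fin q → Bool) → ℝ :=
    fun p v => if p.2 v then 1 else 0
  have g0 : ∀ p v, 0 ≤ g p v := by intro p v; simp only [g]; split_ifs <;> norm_num
  have g1 : ∀ p v, g p v ≤ 1 := by intro p v; simp only [g]; split_ifs <;> norm_num
  have hle1 : ∀ f, acceptProb μ f ≤ 1 := by
    intro f
    rw [← h1]
    refine Finset.sum_le_sum (fun p _ => mul_le_of_le_one_right (h0 p) (g1 p _))
  set W : ℝ := (Fintype.card (Fin N → Fin m → Fin m) : ℝ) with hWdef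
  have hm' : (100:ℝ) ≤ m := by exact_mod_cast hm
  have hmpos : 0 < m := by omega
  have hW : 0 < W := by
    have : Nonempty (Fin m) := ⟨⟨0, hmpos⟩⟩
    simp only [hWdef]
    exact_mod_cast Fintype.card_pos
  -- per-algorithm comparison
  have hp : ∀ p : (Fin q → (Fin n → Bool)) × ((Fin q → Bool) → Bool),
      (∑ T : Fin N → Fin m → Fin m, ∑ k : Fin m × Fin m, ∑ l : Fin m × Fin m, ∑ b : Fin N → Bool,
        g p (fun a => FF e T b (p.1 a))) -
      (∑ T : Fin N → Fin m → Fin m, ∑ k : Fin m × Fin m, ∑ l : Fin m × Fin m, ∑ b : Fin N → Bool,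
        g p (fun a => FN e T b k l (p.1 a))) ≤ 2 ^ N * (4 * q ^ 2 * m ^ 3 * W) := by
    intro p
    have hb := bad_count (N := N) e p.1 hmpos
    refine le_trans ?_ (mul_le_mul_of_nonneg_left hb (by positivity : (0:ℝ) ≤ 2^N))
    simp_rw [← Finset.sum_sub_distrib]
    rw [Finset.mul_sum]
    refine Finset.sum_le_sum (fun T _ => ?_)
    rw [Finset.mul_sum]
    refine Finset.sum_le_sum (fun k _ => ?_)
    rw [Finset.mul_sum]
    refine Finset.sum_le_sum (fun l _ => ?_)
    by_cases hB : Bad e p.1 T k l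
    · rw [if_pos hB, mul_one]
      calc _ ≤ ∑ b : Fin N → Bool, (1:ℝ) := Finset.sum_le_sum (fun b _ => by
            linarith [g0 p (fun a => FN e T b k l (p.1 a)), g1 p (fun a => FF e T b (p.1 a))])
        _ = 2^N := by simp
    · rw [if_neg hB, mul_zero, Finset.sum_sub_distrib, couple e p.1 T k l hB (g p), sub_self]
  have sw : ∀ G : ((Fin q → (Fin n → Bool)) × ((Fin q → Bool) → Bool)) → (Fin N → Fin m → Fin m) → (Fin m × Fin m) → (Fin m × Fin m) → (Fin N → Bool) → ℝ,
      ∑ p, μ p * ∑ T, ∑ k, ∑ l, ∑ b, G p T k l b = ∑ T, ∑ k, ∑ l, ∑ b, ∑ p, μ p * G p T k l b := by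
    intro G
    simp_rw [Finset.mul_sum]
    rw [Finset.sum_comm]
    refine Finset.sum_congr rfl (fun T _ => ?_)
    rw [Finset.sum_comm]
    refine Finset.sum_congr rfl (fun k _ => ?_)
    rw [Finset.sum_comm]
    refine Finset.sum_congr rfl (fun l _ => ?_)
    rw [Finset.sum_comm]
  have hY : 2 ^ N * (m ^ 4 * W * (2/3)) ≤ ∑ p, μ p * (∑ T : Fin N → Fin m → Fin m, ∑ k : Fin m × Fin m, ∑ l : Fin m × Fin m, ∑ b : Fin N → Bool,
        g p (fun a => FF e T b (p.1 a))) := by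
    rw [sw (fun p T k l b => g p (fun a => FF e T b (p.1 a)))]
    calc (2:ℝ) ^ N * (m ^ 4 * W * (2/3)) = ∑ T : Fin N → Fin m → Fin m, ∑ k : Fin m × Fin m, ∑ l : Fin m × Fin m, ∑ b : Fin N → Bool, (2/3 : ℝ) := by
          simp only [Finset.sum_const, Finset.card_univ, nsmul_eq_mul, ← hWdef]
          rw [Fintype.card_prod, Fintype.card_fin, Fintype.card_fun, Fintype.card_fin, Fintype.card_bool]
          push_cast; ring
      _ ≤ _ := by
          refine Finset.sum_le_sum (fun T _ => Finset.sum_le_sum (fun k _ => Finset.sum_le_sum (fun l _ =>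
            Finset.sum_le_sum (fun b _ => ?_))))
          exact hyes _ (FF_mono e T b)
  have hNo : ∑ p, μ p * (∑ T : Fin N → Fin m → Fin m, ∑ k : Fin m × Fin m, ∑ l : Fin m × Fin m, ∑ b : Fin N → Bool,
        g p (fun a => FN e T b k l (p.1 a))) ≤ 2 ^ N * (m ^ 4 * W * (1/3)) + 2 ^ N * (m ^ 4 / 6 * W) := by
    rw [sw (fun p T k l b => g p (fun a => FN e T b k l (p.1 a)))]
    calc _ ≤ ∑ T : Fin N → Fin m → Fin m, ∑ k : Fin m × Fin m, ∑ l : Fin m × Fin m, ∑ b : Fin N → Bool,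
          ((1/3 : ℝ) + if (1:ℝ)/2^13 ≤ YY T k l then (1:ℝ) else 0) := by
          refine Finset.sum_le_sum (fun T _ => Finset.sum_le_sum (fun k _ => Finset.sum_le_sum (fun l _ =>
            Finset.sum_le_sum (fun b _ => ?_))))
          by_cases h : (1:ℝ)/2^13 ≤ YY T k l
          · rw [if_pos h]
            have := hle1 (FN e T b k l)
            refine le_trans this (by norm_num)
          · rw [if_neg h, add_zero]
            exact hno _ (FN_far e he hN T b k l h)
      _ = 2 ^ N * (m ^ 4 * W * (1/3)) + 2 ^ N * ∑ T : Fin N → Fin m → Fin m, ∑ k : Fin m × Fin m, ∑ l : Fin m × Fin m,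
          (if (1:ℝ)/2^13 ≤ YY T k l then (1:ℝ) else 0) := by
          simp only [Finset.sum_add_distrib, Finset.mul_sum]
          congr 1
          · simp only [Finset.sum_const, Finset.card_univ, nsmul_eq_mul, ← hWdef]
            rw [Fintype.card_prod, Fintype.card_fin, Fintype.card_fun, Fintype.card_fin, Fintype.card_bool]
            push_cast; ring
          · refine Finset.sum_congr rfl (fun T _ => Finset.sum_congr rfl (fun k _ => Finset.sum_congr rfl (fun l _ => ?_)))
            simp only [Finset.sum_const, Finset.card_univ, nsmul_eq_mul]
            rw [Fintype.card_fun, Fintype.card_fin, Fintype.card_bool]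
            push_cast; ring
      _ ≤ _ := by
          have := notfar_count (N := N) e he hm hN
          gcongr
  have hdiff : ∑ p, μ p * (∑ T : Fin N → Fin m → Fin m, ∑ k : Fin m × Fin m, ∑ l : Fin m × Fin m, ∑ b : Fin N → Bool,
        g p (fun a => FF e T b (p.1 a))) - ∑ p, μ p * (∑ T : Fin N → Fin m → Fin m, ∑ k : Fin m × Fin m, ∑ l : Fin m × Fin m, ∑ b : Fin N → Bool,
        g p (fun a => FN e T b k l (p.1 a))) ≤ 2 ^ N * (4 * q ^ 2 * m ^ 3 * W) := by
    rw [← Finset.sum_sub_distrib]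
    simp_rw [← mul_sub]
    calc _ ≤ ∑ p, μ p * (2 ^ N * (4 * q ^ 2 * m ^ 3 * W)) :=
          Finset.sum_le_sum (fun p _ => mul_le_mul_of_nonneg_left (hp p) (h0 p))
      _ = _ := by rw [← Finset.sum_mul, h1, one_mul]
  have hfin : (2:ℝ) ^ N * (m ^ 4 * W * (2/3)) ≤ 2 ^ N * (m ^ 4 * W * (1/3)) + 2 ^ N * (m ^ 4 / 6 * W) +
      2 ^ N * (4 * q ^ 2 * m ^ 3 * W) := by linarith
  have hmp : (0:ℝ) < m := by linarith
  have hpos : (0:ℝ) < 2^N * W * m^3 / 6 := by positivity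
  by_contra hcon
  push Not at hcon
  have := mul_lt_mul_of_pos_left hcon hpos
  have e1 : (2:ℝ)^N * W * m^3 / 6 * m = 2^N * (m^4 / 6 * W) := by ring
  have e2 : (2:ℝ)^N * W * m^3 / 6 * (24 * q^2) = 2 ^ N * (4 * q ^ 2 * m ^ 3 * W) := by ring
  rw [e1, e2] at this
  have e3 : (2:ℝ) ^ N * (m ^ 4 * W * (2/3)) - 2 ^ N * (m ^ 4 * W * (1/3)) = 2 * (2 ^ N * (m ^ 4 / 6 * W)) := by ring
  linarith

theorem lower_bound_nonadaptive_two_sided :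
    ∃ ε₀ c : ℝ, 0 < ε₀ ∧ 0 < c ∧ ∃ N : ℕ, ∀ n : ℕ, N ≤ n → ∀ q : ℕ,
      ∀ μ : (Fin q → (Fin n → Bool)) × ((Fin q → Bool) → Bool) → ℝ,
        (∀ p, 0 ≤ μ p) →
        (∑ p : (Fin q → (Fin n → Bool)) × ((Fin q → Bool) → Bool), μ p) = 1 →
        (∀ f : (Fin n → Bool) → Bool, IsMono f → 2/3 ≤ acceptProb μ f) →
        (∀ f : (Fin n → Bool) → Bool, FarFromMono ε₀ f → acceptProb μ f ≤ 1/3) →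
        c * (n : ℝ) ^ ((1 : ℝ)/5) * (Real.logb 2 n) ^ (-((2 : ℝ)/5)) ≤ (q : ℝ) := by
  refine ⟨1/2^14, 1/7, by positivity, by norm_num, 10000, ?_⟩
  intro n hn q μ h0 h1 hyes hno
  set m := Nat.sqrt n with hm
  have hm100 : 100 ≤ m := by
    rw [hm, Nat.le_sqrt]; omega
  have hmm : m * m ≤ n := Nat.sqrt_le n
  have hmm2 : n < (m+1) * (m+1) := Nat.lt_succ_sqrt n
  obtain ⟨e⟩ : Nonempty (Fin m × Fin m ↪ Fin n) :=
    Function.Embedding.nonempty_of_card_le (by simpa using hmm)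
  have hN : ((2^(m-10) : ℕ) : ℝ) * 1024 = 2^m := by
    have : m = (m - 10) + 10 := by omega
    conv_rhs => rw [this, pow_add]
    push_cast; norm_num
  have hb := main_bound (N := 2^(m-10)) e e.injective hm100 hN μ h0 h1 hyes hno
  have hn1 : (1:ℝ) ≤ n := by exact_mod_cast (by omega : 1 ≤ n)
  have hm' : (100:ℝ) ≤ m := by exact_mod_cast hm100
  have hlog : (1:ℝ) ≤ Real.logb 2 n := by
    rw [Real.le_logb_iff_rpow_le (by norm_num) (by linarith)]
    rw [Real.rpow_one]; exact_mod_cast (by omega : 2 ≤ n)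
  have hl : (Real.logb 2 n) ^ (-((2 : ℝ)/5)) ≤ 1 :=
    Real.rpow_le_one_of_one_le_of_nonpos hlog (by norm_num)
  have hq4 : (n:ℝ) ^ ((1:ℝ)/5) ≤ (n:ℝ) ^ ((1:ℝ)/4) :=
    Real.rpow_le_rpow_of_exponent_le hn1 (by norm_num)
  have h4 : ((n:ℝ) ^ ((1:ℝ)/4))^4 = n := by
    rw [← Real.rpow_natCast, ← Real.rpow_mul (by linarith)]; norm_num
  have hp4 : (0:ℝ) ≤ (n:ℝ) ^ ((1:ℝ)/4) := by positivity
  have hp5 : (0:ℝ) ≤ (n:ℝ) ^ ((1:ℝ)/5) := by positivity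
  have hnm : (n:ℝ) ≤ (2 * m)^2 := by
    have : (n:ℝ) ≤ (m+1)*(m+1) := by exact_mod_cast hmm2.le
    nlinarith
  set r := (n:ℝ) ^ ((1:ℝ)/4) with hr
  have hr2 : r^2 ≤ 2 * m := by
    refine (pow_le_pow_iff_left₀ (by positivity) (by positivity) two_ne_zero).mp ?_
    have h5 : (r^2)^2 = r^4 := by ring
    rw [h5, h4]
    exact hnm
  have hrq : r ≤ 7 * q := by
    refine (pow_le_pow_iff_left₀ (by positivity) (by positivity) two_ne_zero).mp ?_
    nlinarith
  calc 1/7 * (n:ℝ) ^ ((1 : ℝ)/5) * (Real.logb 2 n) ^ (-((2 : ℝ)/5)) ≤ 1/7 * (n:ℝ) ^ ((1 : ℝ)/5) * 1 := by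
        gcongr
    _ ≤ 1/7 * r := by rw [mul_one]; gcongr
    _ ≤ q := by linarith
end

section
/- There exists a universal constant ε₀ > 0 such that, for every δ > 0, there is an N such that for all n ≥ N: if f is drawn from D_no, then with probability at least 1 − δ, f is ε₀-far from monotone (i.e., dist(f,g) > ε₀ for every monotone g : {−1,1}^n → {−1,1}). -/
open Finset

/-- A point of the hypercube `{-1,1}^n` encoded as a Boolean vector:
`false ↦ -1`, `true ↦ 1`. -/
noncomputable def pm (b : Bool) : ℝ := if b then 1 else -1

/-- The LTF `sign(ν₁x₁ + ⋯ + νₙxₙ)` drawn from `D_no`, where the Boolean vector `b`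
encodes the weights: `ν i = -1` if `b i = false` and `ν i = 7/3` if `b i = true`.
`sign(t) = 1` iff `t ≥ 0`; the output `1` is encoded by `true` and `-1` by `false`. -/
noncomputable def fNo {n : ℕ} (b : Fin n → Bool) : (Fin n → Bool) → Bool :=
  fun x => if 0 ≤ ∑ i : Fin n, (if b i then (7 : ℝ)/3 else -1) * pm (x i) then true else false

/-- The probability weight that `D_no` assigns to the weight vector encoded by `b`:
each coordinate is independently `-1` with probability `1/10` and `7/3` with
probability `9/10`. -/
noncomputable def wNo {n : ℕ} (b : Fin n → Bool) : ℝ :=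
  ∏ i : Fin n, (if b i then (9 : ℝ)/10 else 1/10)


open Real in
lemma cosh_lower (x : ℝ) : 1 + x^2/2 ≤ Real.cosh x := by
  have h : Real.cosh x = 2 * Real.sinh (x/2)^2 + 1 := by
    have := Real.cosh_two_mul (x/2)
    rw [Real.cosh_sq] at this
    rw [show x = 2 * (x/2) by ring, this]
    ring_nf
  have h2 : (x/2)^2 ≤ Real.sinh (x/2)^2 := by
    rw [← sq_abs (x/2), ← sq_abs (Real.sinh (x/2)), Real.abs_sinh]
    have : |x/2| ≤ Real.sinh |x/2| := Real.self_le_sinh_iff.2 (abs_nonneg _)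
    gcongr
  rw [h]; linarith

/-- moment generating function of a signed sum -/
lemma mgf {n : ℕ} (c : Fin n → ℝ) :
    ∑ x : Fin n → Bool, Real.exp (∑ i, c i * pm (x i)) = 2^n * ∏ i, Real.cosh (c i) := by
  have := Finset.prod_univ_sum (fun _ : Fin n => (Finset.univ : Finset Bool))
    (fun i y => Real.exp (c i * pm y))
  rw [Fintype.piFinset_univ] at this
  simp_rw [Real.exp_sum]
  rw [← this]
  have h : ∀ i, ∑ y : Bool, Real.exp (c i * pm y) = 2 * Real.cosh (c i) := by
    intro i
    simp [pm, Real.cosh_eq]; ring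
  simp_rw [h]
  rw [Finset.prod_mul_distrib]
  simp

/-- the negative part -/
noncomputable def NN {n : ℕ} (b x : Fin n → Bool) : ℝ := ∑ i, (if b i then (0:ℝ) else 1) * pm (x i)
/-- the positive part -/
noncomputable def PP {n : ℕ} (b x : Fin n → Bool) : ℝ := ∑ i, (if b i then (7:ℝ)/3 else 0) * pm (x i)
/-- number of negative weights -/
def mm {n : ℕ} (b : Fin n → Bool) : ℕ := (Finset.univ.filter (fun i => b i = false)).card
/-- number of positive weights -/
def kk {n : ℕ} (b : Fin n → Bool) : ℕ := (Finset.univ.filter (fun i => b i = true)).card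

lemma kk_le {n : ℕ} (b : Fin n → Bool) : kk b ≤ n := by
  unfold kk; exact (Finset.card_le_univ _).trans (by simp)
lemma mm_le {n : ℕ} (b : Fin n → Bool) : mm b ≤ n := by
  unfold mm; exact (Finset.card_le_univ _).trans (by simp)

lemma mgfNP {n : ℕ} (b : Fin n → Bool) (t s : ℝ) :
    ∑ x : Fin n → Bool, Real.exp (t * NN b x + s * PP b x)
      = 2^n * (Real.cosh t ^ mm b * Real.cosh (s * (7/3)) ^ kk b) := by
  have h := mgf (fun i => if b i then s * (7/3) else t)
  have e : ∀ x, t * NN b x + s * PP b x = ∑ i, (if b i then s * (7/3) else t) * pm (x i) := by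
    intro x
    unfold NN PP
    rw [Finset.mul_sum, Finset.mul_sum, ← Finset.sum_add_distrib]
    refine Finset.sum_congr rfl fun i _ => ?_
    split_ifs <;> ring
  simp_rw [e]
  rw [h]
  congr 1
  have : ∀ i, Real.cosh (if b i then s * (7/3) else t) = if b i = false then Real.cosh t else Real.cosh (s * (7/3)) := by
    intro i; cases b i <;> simp
  simp_rw [this]
  rw [Finset.prod_ite]
  simp [mm, kk]

lemma fNo_eq {n : ℕ} (b x : Fin n → Bool) :
    fNo b x = if 0 ≤ PP b x - NN b x then true else false := by
  unfold fNo
  have : ∑ i : Fin n, (if b i then (7 : ℝ)/3 else -1) * pm (x i) = PP b x - NN b x := by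
    unfold NN PP
    rw [← Finset.sum_sub_distrib]
    refine Finset.sum_congr rfl fun i _ => ?_
    split_ifs <;> ring
  rw [this]

/-- flip the negative coordinates -/
def flipN {n : ℕ} (b x : Fin n → Bool) : Fin n → Bool := fun i => if b i then x i else !(x i)

lemma pm_not (a : Bool) : pm (!a) = - pm a := by cases a <;> simp [pm]

lemma flipN_inv {n : ℕ} (b : Fin n → Bool) : Function.Involutive (flipN b) := by
  intro x; funext i; unfold flipN; cases b i <;> simp

lemma NN_flip {n : ℕ} (b x : Fin n → Bool) : NN b (flipN b x) = - NN b x := by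
  unfold NN flipN
  rw [← Finset.sum_neg_distrib]
  refine Finset.sum_congr rfl fun i _ => ?_
  split_ifs <;> simp [pm_not]

lemma PP_flip {n : ℕ} (b x : Fin n → Bool) : PP b (flipN b x) = PP b x := by
  unfold PP flipN
  refine Finset.sum_congr rfl fun i _ => ?_
  split_ifs <;> simp

lemma sum_invol {α : Type*} [Fintype α] (σ : α → α) (h : Function.Involutive σ) (F : α → ℝ) :
    2 * ∑ x, F x = ∑ x, (F x + F (σ x)) := by
  rw [Finset.sum_add_distrib, show ∑ x, F (σ x) = ∑ x, F x from Equiv.sum_comp h.toPerm F]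
  ring

open Classical in
/-- good event indicator -/
noncomputable def good {n : ℕ} (b : Fin n → Bool) (A : ℝ) (x : Fin n → Bool) : ℝ :=
  if A ≤ NN b x ∧ |PP b x| < A then 1 else 0

lemma sum_fN {n : ℕ} (b : Fin n → Bool) (A : ℝ) (hA : 0 < A) :
    ∑ x, pm (fNo b x) * NN b x ≤ - (A * ∑ x, good b A x) := by
  have h := sum_invol (flipN b) (flipN_inv b) (fun x => pm (fNo b x) * NN b x)
  have h2 : ∑ x, (pm (fNo b x) * NN b x + pm (fNo b (flipN b x)) * NN b (flipN b x))
      ≤ ∑ x, - (2 * A * good b A x) := by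
    refine Finset.sum_le_sum fun x _ => ?_
    rw [fNo_eq, fNo_eq, NN_flip, PP_flip]
    generalize hN : NN b x = N
    generalize hP : PP b x = P
    unfold good
    rw [hN, hP]
    unfold pm
    by_cases hg : A ≤ N ∧ |P| < A
    · obtain ⟨h1, h2⟩ := hg
      have h3 := abs_lt.1 h2
      have e1 : ¬ (0 ≤ P - N) := by linarith
      have e2 : 0 ≤ P - -N := by linarith
      simp [h1, h2]
      rw [if_neg (by linarith), if_pos (by linarith)]
      linarith
    · rw [if_neg hg]
      by_cases e1 : 0 ≤ P - N <;> by_cases e2 : 0 ≤ P - -N <;> simp only [e1, e2, if_true, if_false] <;> simp <;> linarith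
  rw [Finset.sum_neg_distrib, ← Finset.mul_sum] at h2
  linarith

lemma mono_coord {n : ℕ} (g : (Fin n → Bool) → Bool) (hg : IsMono g) (i : Fin n) :
    0 ≤ ∑ x, pm (g x) * pm (x i) := by
  let σ : (Fin n → Bool) → (Fin n → Bool) := fun x => Function.update x i (!(x i))
  have hσ : Function.Involutive σ := by
    intro x; simp [σ]
  have h := sum_invol σ hσ (fun x => pm (g x) * pm (x i))
  have h2 : 0 ≤ ∑ x, (pm (g x) * pm (x i) + pm (g (σ x)) * pm (σ x i)) := by
    refine Finset.sum_nonneg fun x _ => ?_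
    have hs : σ x i = !(x i) := by simp [σ]
    rw [hs, pm_not]
    cases hx : x i
    · have hle : x ≤ σ x := by
        intro j
        by_cases hj : j = i
        · subst hj; simp [hx]
        · simp [σ, hj]
      have := hg _ _ hle
      revert this
      cases g x <;> cases g (σ x) <;> simp [pm]
    · have hle : σ x ≤ x := by
        intro j
        by_cases hj : j = i
        · subst hj; simp [hx]
        · simp [σ, hj]
      have := hg _ _ hle
      revert this
      cases g x <;> cases g (σ x) <;> simp [pm]
  linarith

lemma mono_N {n : ℕ} (b : Fin n → Bool) (g : (Fin n → Bool) → Bool) (hg : IsMono g) :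
    0 ≤ ∑ x, pm (g x) * NN b x := by
  unfold NN
  simp_rw [Finset.mul_sum]
  rw [Finset.sum_comm]
  refine Finset.sum_nonneg fun i _ => ?_
  cases hb : b i
  · simpa [hb] using mono_coord g hg i
  · simp

lemma sum_N_sq {n : ℕ} (hn : 0 < n) (b : Fin n → Bool) :
    ∑ x, NN b x ^ 2 ≤ 2^n * (4 * n) := by
  have hn' : (0:ℝ) < n := by exact_mod_cast hn
  set r := Real.sqrt n with hr
  have hr0 : 0 < r := Real.sqrt_pos.2 hn'
  have hr2 : r^2 = n := Real.sq_sqrt hn'.le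
  have h1 := mgfNP b (1/r) 0
  have h2 := mgfNP b (-(1/r)) 0
  simp only [zero_mul, add_zero, Real.cosh_zero, one_pow, mul_one, Real.cosh_neg] at h1 h2
  have hp : ∀ x, NN b x ^ 2 ≤ n * (Real.exp (1/r * NN b x) + Real.exp (-(1/r) * NN b x)) := by
    intro x
    have := cosh_lower (1/r * NN b x)
    rw [Real.cosh_eq, ← neg_mul] at this
    have e : (1/r * NN b x)^2 = NN b x ^2 / n := by rw [← hr2]; field_simp
    rw [e] at this
    have h3 : NN b x ^2 / n ≤ (Real.exp (1/r * NN b x) + Real.exp (-(1/r) * NN b x)) := by linarith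
    rw [div_le_iff₀ hn'] at h3
    linarith
  have hc : Real.cosh (1/r) ^ mm b ≤ 2 := by
    calc Real.cosh (1/r) ^ mm b ≤ Real.cosh (1/r) ^ n :=
          pow_le_pow_right₀ (Real.one_le_cosh _) (mm_le b)
      _ ≤ (Real.exp ((1/r)^2/2))^n := by
          gcongr
          exact Real.cosh_le_exp_half_sq _
      _ = Real.exp (1/2) := by
          rw [← Real.exp_nat_mul]; congr 1
          rw [div_pow, hr2]; field_simp
      _ ≤ 2 := by
          have h := Real.exp_one_lt_d9
          have : Real.exp (1/2) ^2 = Real.exp 1 := by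
            rw [← Real.exp_nat_mul]; norm_num
          have h0 := Real.exp_pos (1/2)
          nlinarith
  calc ∑ x, NN b x ^ 2 ≤ ∑ x, n * (Real.exp (1/r * NN b x) + Real.exp (-(1/r) * NN b x)) :=
        Finset.sum_le_sum fun x _ => hp x
    _ = n * (2^n * Real.cosh (1/r)^mm b + 2^n * Real.cosh (1/r)^mm b) := by
        rw [← Finset.mul_sum, Finset.sum_add_distrib, h1, h2]
    _ ≤ n * (2^n * 2 + 2^n * 2) := by gcongr
    _ = _ := by ring

lemma good_lower {n : ℕ} (hn : 125000 ≤ n) (b : Fin n → Bool) (hm : n ≤ 20 * mm b) :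
    2^n * Real.exp (-500000) ≤ ∑ x, good b (5 * Real.sqrt n) x := by
  have hn' : (125000:ℝ) ≤ n := by exact_mod_cast hn
  have hm' : (n:ℝ) ≤ 20 * mm b := by exact_mod_cast hm
  have hn0 : (0:ℝ) < n := by linarith
  set r := Real.sqrt n with hr
  have hr0 : 0 < r := Real.sqrt_pos.2 hn0
  have hr2 : r^2 = n := Real.sq_sqrt hn0.le
  set A := 5 * r with hA
  have h0 := mgfNP b (500/r) 0
  have h1 := mgfNP b (500/r) (1/r)
  have h2 := mgfNP b (500/r) (-(1/r))
  have h3 := mgfNP b (1000/r) 0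
  rw [neg_mul, Real.cosh_neg] at h2
  simp only [zero_mul, add_zero, Real.cosh_zero, one_pow, mul_one] at h0 h3
  set Z := fun x => Real.exp (500/r * NN b x) with hZ
  have hg01 : ∀ x, good b A x ^ 2 = good b A x := by
    intro x; unfold good; split_ifs <;> simp
  -- pointwise
  have hpt : ∀ x, Z x - Real.exp 2500 - Real.exp (-5) * Real.exp (500/r * NN b x + 1/r * PP b x)
      - Real.exp (-5) * Real.exp (500/r * NN b x + -(1/r) * PP b x) ≤ Z x * good b A x := by
    intro x
    have p1 := Real.exp_pos (500/r * NN b x + 1/r * PP b x)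
    have p2 := Real.exp_pos (500/r * NN b x + -(1/r) * PP b x)
    have p3 := Real.exp_pos (-5)
    have p4 := Real.exp_pos 2500
    have q1 := mul_pos p3 p1
    have q2 := mul_pos p3 p2
    unfold good
    split_ifs with hg
    · linarith
    · rw [mul_zero]
      by_cases hN : A ≤ NN b x
      · have hP : A ≤ |PP b x| := by
          by_contra hcon
          exact hg ⟨hN, not_le.1 hcon⟩
        rcases le_abs.1 hP with hP | hP
        · have : Z x ≤ Real.exp (-5) * Real.exp (500/r * NN b x + 1/r * PP b x) := by
            rw [← Real.exp_add]
            apply Real.exp_le_exp.2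
            have : 5 ≤ 1/r * PP b x := by
              rw [one_div_mul_eq_div, le_div_iff₀ hr0]; exact hP
            linarith
          linarith
        · have : Z x ≤ Real.exp (-5) * Real.exp (500/r * NN b x + -(1/r) * PP b x) := by
            rw [← Real.exp_add]
            apply Real.exp_le_exp.2
            have : 5 ≤ 1/r * (-PP b x) := by
              rw [one_div_mul_eq_div, le_div_iff₀ hr0]; exact hP
            linarith
          linarith
      · have : Z x ≤ Real.exp 2500 := by
          apply Real.exp_le_exp.2
          have : NN b x ≤ 5 * r := (not_le.1 hN).le
          calc 500/r * NN b x ≤ 500/r * (5*r) := by gcongr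
            _ = 2500 := by field_simp; norm_num
        linarith
  have hsum := Finset.sum_le_sum fun x (_ : x ∈ Finset.univ) => hpt x
  rw [Finset.sum_sub_distrib, Finset.sum_sub_distrib, Finset.sum_sub_distrib, ← Finset.mul_sum,
    ← Finset.mul_sum, h0, h1, h2] at hsum
  simp only [Finset.sum_const, Finset.card_univ, Fintype.card_fun, Fintype.card_bool, Fintype.card_fin, nsmul_eq_mul, Nat.cast_pow, Nat.cast_ofNat] at hsum
  set C := Real.cosh (500/r) ^ mm b with hC
  set D := Real.cosh (1/r * (7/3)) ^ kk b with hD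
  have hClow : Real.exp 3125 ≤ C := by
    have hu : Real.exp (62500 / n) ≤ Real.cosh (500/r) := by
      refine le_trans ?_ (cosh_lower _)
      rw [div_pow, hr2]
      set u := (62500:ℝ)/n with hu
      have hu0 : 0 ≤ u := by positivity
      have hu1 : u ≤ 1/2 := by rw [hu, div_le_iff₀ hn0]; linarith
      have e : 1 + 500^2 / (n:ℝ) / 2 = 1 + 2 * u := by rw [hu]; ring
      rw [e]
      have := Real.exp_bound_div_one_sub_of_interval hu0 (by linarith : u < 1)
      refine this.trans ?_
      rw [div_le_iff₀ (by linarith)]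
      nlinarith
    calc Real.exp 3125 ≤ Real.exp (mm b * (62500 / n)) := by
          apply Real.exp_le_exp.2
          rw [← mul_div_assoc, le_div_iff₀ hn0]
          linarith
      _ = Real.exp (62500 / n) ^ mm b := Real.exp_nat_mul _ _
      _ ≤ C := by rw [hC]; gcongr
  have hDup : D ≤ Real.exp 3 := by
    calc D ≤ Real.cosh (1/r * (7/3)) ^ n :=
          pow_le_pow_right₀ (Real.one_le_cosh _) (kk_le b)
      _ ≤ (Real.exp ((1/r * (7/3))^2/2))^n := by
          gcongr
          exact Real.cosh_le_exp_half_sq _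
      _ = Real.exp (49/18) := by
          rw [← Real.exp_nat_mul]; congr 1
          rw [mul_pow, div_pow, hr2]; field_simp; norm_num
      _ ≤ Real.exp 3 := by apply Real.exp_le_exp.2; norm_num
  have hE : Real.cosh (1000/r) ^ mm b ≤ Real.exp 500000 := by
    calc Real.cosh (1000/r) ^ mm b ≤ Real.cosh (1000/r) ^ n :=
          pow_le_pow_right₀ (Real.one_le_cosh _) (mm_le b)
      _ ≤ (Real.exp ((1000/r)^2/2))^n := by
          gcongr
          exact Real.cosh_le_exp_half_sq _
      _ = Real.exp 500000 := by
          rw [← Real.exp_nat_mul]; congr 1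
          rw [div_pow, hr2]; field_simp; norm_num
  have hED : Real.exp (-5) * D ≤ 1/4 := by
    have h : Real.exp (-5) * D ≤ Real.exp (-5) * Real.exp 3 := by gcongr
    rw [← Real.exp_add] at h
    refine h.trans ?_
    rw [show (-5:ℝ)+3 = -2 by norm_num, Real.exp_neg, one_div]
    apply inv_anti₀ (by norm_num)
    have := Real.quadratic_le_exp_of_nonneg (show (0:ℝ) ≤ 2 by norm_num)
    linarith
  have hbig : 4 * Real.exp 2500 ≤ Real.exp 3125 := by
    rw [show (3125:ℝ) = 625 + 2500 by norm_num, Real.exp_add]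
    gcongr
    have := Real.add_one_le_exp (625:ℝ)
    linarith
  have h2500 : 1 ≤ Real.exp 2500 := Real.one_le_exp (by norm_num)
  have hT : (0:ℝ) < 2^n := by positivity
  have hmain : (2:ℝ)^n ≤ ∑ x, Z x * good b A x := by
    refine le_trans ?_ hsum
    have hCD : C * (Real.exp (-5) * D) ≤ C * (1/4) := by
      have : 0 ≤ C := by positivity
      gcongr
    have : 1 ≤ C - Real.exp 2500 - 2 * (C * (Real.exp (-5) * D)) := by linarith
    have := mul_le_mul_of_nonneg_left this hT.le
    linarith
  have hcs := Finset.sum_mul_sq_le_sq_mul_sq Finset.univ Z (good b A)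
  simp_rw [hg01] at hcs
  have hZ2 : ∀ x, Z x ^ 2 = Real.exp (1000/r * NN b x) := by
    intro x
    rw [hZ]; simp only
    rw [← Real.exp_nat_mul]; congr 1; push_cast; ring
  simp_rw [hZ2] at hcs
  rw [h3] at hcs
  set G := ∑ x, good b A x with hG
  have hG0 : 0 ≤ G := Finset.sum_nonneg fun x _ => by unfold good; split_ifs <;> norm_num
  have k1 : ((2:ℝ)^n)^2 ≤ 2^n * Real.exp 500000 * G := by
    calc ((2:ℝ)^n)^2 ≤ (∑ x, Z x * good b A x)^2 := by gcongr
      _ ≤ _ := hcs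
      _ ≤ _ := by gcongr
  have k2 : (2:ℝ)^n ≤ Real.exp 500000 * G := by
    refine le_of_mul_le_mul_left ?_ hT
    linarith [k1, sq ((2:ℝ)^n)]
  rw [Real.exp_neg, ← div_eq_mul_inv, div_le_iff₀ (Real.exp_pos _)]
  linarith

lemma far {n : ℕ} (hn : 125000 ≤ n) (b : Fin n → Bool) (hm : n ≤ 20 * mm b) :
    FarFromMono (Real.exp (-500000) ^ 2) (fNo b) := by
  intro g hg
  have hn' : (125000:ℝ) ≤ n := by exact_mod_cast hn
  have hn0 : (0:ℝ) < n := by linarith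
  have hr0 : 0 < Real.sqrt n := Real.sqrt_pos.2 hn0
  have hr2 : Real.sqrt n^2 = n := Real.sq_sqrt hn0.le
  have h1 := good_lower hn b hm
  have h2 := sum_fN b (5 * Real.sqrt n) (by positivity)
  have h3 := mono_N b g hg
  have h4 := sum_N_sq (by omega) b
  set p := Real.exp (-500000) with hp
  have hp0 : 0 < p := Real.exp_pos _
  have hT : (0:ℝ) < 2^n := by positivity
  have h5 : 5 * Real.sqrt n * (2^n * p) ≤ ∑ x, (pm (g x) - pm (fNo b x)) * NN b x := by
    simp_rw [sub_mul]
    rw [Finset.sum_sub_distrib]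
    have := mul_le_mul_of_nonneg_left h1 (show 0 ≤ 5 * Real.sqrt n by positivity)
    linarith
  have hcs := Finset.sum_mul_sq_le_sq_mul_sq Finset.univ (fun x => pm (g x) - pm (fNo b x)) (NN b)
  have h6 : ∑ x, (pm (g x) - pm (fNo b x))^2 = 4 * (2^n * distB (fNo b) g) := by
    unfold distB
    have : (Fintype.card (Fin n → Bool) : ℝ) = 2^n := by simp
    rw [this, mul_div_cancel₀ _ hT.ne', Finset.card_filter]
    push_cast
    rw [Finset.mul_sum]
    refine Finset.sum_congr rfl fun x _ => ?_
    cases g x <;> cases fNo b x <;> simp [pm] <;> norm_num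
  rw [h6] at hcs
  set d := distB (fNo b) g with hd
  have hd0 : 0 ≤ d := by rw [hd]; unfold distB; positivity
  have h7 : (5 * Real.sqrt n * (2^n * p))^2 ≤ 4 * (2^n * d) * (2^n * (4 * n)) := by
    calc _ ≤ _ := by gcongr
      _ ≤ _ := hcs
      _ ≤ _ := by gcongr
  have h8 : (2^n * 2^n * (n:ℝ)) * (25 * p^2) ≤ (2^n * 2^n * n) * (16 * d) := by
    have e : (5 * Real.sqrt n * (2^n * p))^2 = (2^n * 2^n * (n:ℝ)) * (25 * p^2) := by
      rw [mul_pow, mul_pow, hr2]; ring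
    rw [← e]; linarith
  have h9 := le_of_mul_le_mul_left h8 (by positivity)
  have : 0 < p^2 := by positivity
  linarith

lemma sum_prod {n : ℕ} (u v : ℝ) :
    ∑ b : Fin n → Bool, ∏ i, (if b i then u else v) = (u + v)^n := by
  have := Finset.prod_univ_sum (fun _ : Fin n => (Finset.univ : Finset Bool))
    (fun _ y => if y then u else v)
  rw [Fintype.piFinset_univ] at this
  rw [← this]
  simp

lemma tail {n : ℕ} (b : Fin n → Bool) (h : ¬ n ≤ 20 * mm b) :
    1 ≤ ∏ i, (if b i then (26/25:ℝ) else (26/25) * (25/26)^20) := by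
  have e : ∀ i, (if b i then (26/25:ℝ) else (26/25) * (25/26)^20)
      = (26/25) * (if b i = false then (25/26)^20 else 1) := by
    intro i; cases b i <;> simp
  simp_rw [e]
  rw [Finset.prod_mul_distrib, Finset.prod_ite]
  simp only [Finset.prod_const, Finset.card_univ, Fintype.card_fin, one_pow, mul_one]
  change 1 ≤ (26/25:ℝ)^n * ((25/26)^20)^mm b
  rw [← pow_mul]
  calc (1:ℝ) = (26/25)^(20 * mm b) * (25/26)^(20 * mm b) := by rw [← mul_pow]; norm_num
    _ ≤ _ := by
      gcongr
      · norm_num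
      · omega

open Classical in
theorem dno_far_from_monotone_whp :
    ∃ ε₀ : ℝ, 0 < ε₀ ∧ ∀ δ : ℝ, 0 < δ → ∃ N : ℕ, ∀ n : ℕ, N ≤ n →
      1 - δ ≤ ∑ b : Fin n → Bool, wNo b * (if FarFromMono ε₀ (fNo b) then 1 else 0) := by
  refine ⟨Real.exp (-500000) ^ 2, by positivity, fun δ hδ => ?_⟩
  obtain ⟨N, hN⟩ := exists_pow_lt_of_lt_one hδ (show (99/100:ℝ) < 1 by norm_num)
  refine ⟨max N 125000, fun n hn => ?_⟩
  have hnN : N ≤ n := le_of_max_le_left hn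
  have hn1 : 125000 ≤ n := le_of_max_le_right hn
  have hδn : (99/100:ℝ)^n ≤ δ :=
    (pow_le_pow_of_le_one (by norm_num) (by norm_num) hnN).trans hN.le
  have hw0 : ∀ b : Fin n → Bool, 0 ≤ wNo b := fun b =>
    Finset.prod_nonneg fun i _ => by split_ifs <;> norm_num
  have hpt : ∀ b : Fin n → Bool, wNo b
      - ∏ i, (if b i then (9/10 * (26/25):ℝ) else 1/10 * ((26/25) * (25/26)^20))
      ≤ wNo b * (if FarFromMono (Real.exp (-500000) ^ 2) (fNo b) then 1 else 0) := by
    intro b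
    have e : ∏ i, (if b i then (9/10 * (26/25):ℝ) else 1/10 * ((26/25) * (25/26)^20))
        = wNo b * ∏ i, (if b i then (26/25:ℝ) else (26/25) * (25/26)^20) := by
      unfold wNo
      rw [← Finset.prod_mul_distrib]
      refine Finset.prod_congr rfl fun i _ => ?_
      split_ifs <;> rfl
    rw [e]
    by_cases h : n ≤ 20 * mm b
    · rw [if_pos (far hn1 b h)]
      have : 0 ≤ ∏ i, (if b i then (26/25:ℝ) else (26/25) * (25/26)^20) :=
        Finset.prod_nonneg fun i _ => by split_ifs <;> norm_num
      have := mul_nonneg (hw0 b) this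
      linarith
    · have h1 := mul_le_mul_of_nonneg_left (tail b h) (hw0 b)
      have : 0 ≤ wNo b * (if FarFromMono (Real.exp (-500000) ^ 2) (fNo b) then 1 else 0 : ℝ) :=
        mul_nonneg (hw0 b) (by split_ifs <;> norm_num)
      linarith
  refine le_trans ?_ (Finset.sum_le_sum fun b _ => hpt b)
  rw [Finset.sum_sub_distrib, sum_prod]
  have hw : ∑ b : Fin n → Bool, wNo b = 1 := by
    unfold wNo
    rw [sum_prod]; norm_num
  rw [hw]
  have : (9/10 * (26/25) + 1/10 * ((26/25) * (25/26)^20) : ℝ)^n ≤ (99/100)^n := by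
    gcongr
    norm_num
  linarith
end
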